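/- arXiv:1703.05420 — 12 statements merged into one kernel-verified Lean document; each statement's English description precedes it below -/
import Mathlib

section
/- Let p be a prime and let L be a separably closed field of characteristic p. Then the map ℘ = F − id : W(L) → W(L), sending a Witt vector x to Fx − x where F is the Witt vector Frobenius, is surjective. -/
namespace WittVector

variable {p : ℕ} [Fact p.Prime]

theorem coeff_zero_sub {R : Type*} [CommRing R] (x y : WittVector p R) :
    (x - y).coeff 0 = x.coeff 0 - y.coeff 0 :=
  map_sub (constantCoeff : WittVector p R →+* R) x y

theorem eq_teichmuller_add_verschiebung_shift {R : Type*} [CommRing R] (x : WittVector p R) :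
    x = teichmuller p (x.coeff 0) + verschiebung (x.shift 1) := by
  ext n
  rw [coeff_add_of_disjoint]
  · cases n with
    | zero => simp
    | succ n =>
      rw [verschiebung_coeff_succ, teichmuller_coeff_pos _ _ _ n.succ_pos, zero_add, shift_coeff,
        add_comm]
  · rintro (_ | n)
    · exact Or.inr (verschiebung_coeff_zero _)
    · exact Or.inl (teichmuller_coeff_pos _ _ _ n.succ_pos)

theorem eq_zero_of_forall_eq_verschiebung_succ {R : Type*} [CommRing R] (d : ℕ → WittVector p R)
    (hd : ∀ n, d n = verschiebung (d (n + 1))) (n : ℕ) : d n = 0 := by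
  ext k
  induction k generalizing n with
  | zero => rw [hd, verschiebung_coeff_zero, zero_coeff]
  | succ k ih => rw [hd, verschiebung_coeff_succ, ih, zero_coeff, zero_coeff]

variable {L : Type*} [Field L] [CharP L p] [IsSepClosed L]

theorem exists_eq_frobenius_teichmuller_sub_add_verschiebung (y : WittVector p L) :
    ∃ (a : L) (z : WittVector p L),
      y = (frobenius (teichmuller p a) - teichmuller p a) + verschiebung z := by
  obtain ⟨a, ha⟩ := IsSepClosed.exists_root_C_mul_X_pow_add_C_mul_X_add_C' p p
    (1 : L) (-1) (-y.coeff 0) dvd_rfl (Fact.out : p.Prime).two_le (neg_ne_zero.mpr one_ne_zero)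
  refine ⟨a, (y - (frobenius (teichmuller p a) - teichmuller p a)).shift 1, ?_⟩
  have h0 : (y - (frobenius (teichmuller p a) - teichmuller p a)).coeff 0 = 0 := by
    rw [coeff_zero_sub, coeff_zero_sub, coeff_frobenius_charP, teichmuller_coeff_zero]
    linear_combination -ha
  have h := eq_teichmuller_add_verschiebung_shift
    (y - (frobenius (teichmuller p a) - teichmuller p a))
  rw [h0, teichmuller_zero, zero_add] at h
  rw [← h, add_sub_cancel]

end WittVector

open WittVector in
/-- Let `p` be a prime and `L` a separably closed field of characteristic `p`.
Then `℘ = F - id : W(L) → W(L)` is surjective, where `F` is the Witt vector Frobenius. -/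
theorem wittVector_artinSchreier_surjective (p : ℕ) [Fact p.Prime]
    (L : Type*) [Field L] [CharP L p] [IsSepClosed L] :
    Function.Surjective (fun x : WittVector p L => WittVector.frobenius x - x) := by
  intro y
  choose a z hz using exists_eq_frobenius_teichmuller_sub_add_verschiebung (p := p) (L := L)
  let r (n : ℕ) : WittVector p L := z^[n] y
  let x (n : ℕ) : WittVector p L := WittVector.mk p fun i => a (r (n + i))
  have hr (n : ℕ) : r n = (frobenius (teichmuller p (a (r n))) - teichmuller p (a (r n))) +
      verschiebung (r (n + 1)) := by
    simpa only [r, Function.iterate_succ_apply'] using hz (r n)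
  have hx (n : ℕ) : x n = teichmuller p (a (r n)) + verschiebung (x (n + 1)) := by
    have hshift : (x n).shift 1 = x (n + 1) := by
      ext i
      simp only [shift_coeff, x, coeff_mk, add_assoc]
    rw [← hshift]
    exact eq_teichmuller_add_verschiebung_shift (x n)
  refine ⟨x 0, (sub_eq_zero.mp (eq_zero_of_forall_eq_verschiebung_succ
    (fun n => r n - (frobenius (x n) - x n)) (fun n => ?_) 0)).symm⟩
  have hcomm : frobenius (verschiebung (x (n + 1))) = verschiebung (frobenius (x (n + 1))) :=
    (verschiebung_frobenius_comm (p := p) (x (n + 1))).symm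
  rw [hr n, hx n, map_add, hcomm, map_sub, map_sub]
  ring
end

section
/- Let p be a prime and let K be a field of characteristic p. Then the kernel of the additive group homomorphism ℘ = F − id : W(K) → W(K) is exactly the image of the natural ring homomorphism W(𝔽_p) → W(K) induced by the inclusion 𝔽_p → K; in other words, the kernel of ℘ is a copy of ℤ_p = W(𝔽_p), consisting of the Witt vectors all of whose coordinates lie in 𝔽_p. -/
/-- Let `p` be a prime and `K` a field of characteristic `p`. The kernel of the
additive map `℘ = F - id : W(K) → W(K)` is exactly the image of the natural ring homomorphism
`W(𝔽_p) → W(K)` induced by the inclusion `𝔽_p → K`, i.e. a copy of `ℤ_p = W(𝔽_p)`. -/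
theorem wittVector_artinSchreier_kernel (p : ℕ) [Fact p.Prime]
    (K : Type*) [Field K] [CharP K p] (x : WittVector p K) :
    WittVector.frobenius x - x = 0 ↔
      x ∈ Set.range (WittVector.map (ZMod.castHom (dvd_refl p) K) :
        WittVector p (ZMod p) → WittVector p K) := by
  rw [sub_eq_zero]
  constructor
  · intro h
    have hx : ∀ n, ∃ a : ZMod p, ZMod.castHom (dvd_refl p) K a = x.coeff n := fun n ↦ by
      have hn : x.coeff n ∈ (⊥ : Subfield K) := by
        rw [Subfield.mem_bot_iff_pow_eq_self K p, ← WittVector.coeff_frobenius_charP, h]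
      rwa [← ZMod.fieldRange_castHom_eq_bot p] at hn
    choose a ha using hx
    exact ⟨WittVector.mk p a, WittVector.ext ha⟩
  · rintro ⟨y, rfl⟩
    ext n
    rw [WittVector.coeff_frobenius_charP, WittVector.map_coeff, ← map_pow, ZMod.pow_card]
end

section
/- Let p be a prime, K a field of characteristic p with separable closure K^sep, and let a, b ∈ W(K) with a ≡ b (mod ℘W(K)). Let x = (x_0, x_1, …) and x' = (x'_0, x'_1, …) be Witt vectors in W(K^sep) with ℘x = a and ℘x' = b (images taken in W(K^sep)). Then the intermediate fields K(x_0, x_1, …) and K(x'_0, x'_1, …) of K^sep/K generated over K by all the coordinates coincide. In particular, the field K(℘^{-1}a) := K(x_0, x_1, …) depends only on the class of a in W(K)/℘W(K). -/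
open IntermediateField in
/-- If two Witt vectors over `L` differ by a Witt vector over `K`, then each coordinate of the first
lies in the field generated over `K` by the coordinates of the second. -/
theorem WittVector.adjoin_coeff_le_of_eq_add_map {p : ℕ} [Fact p.Prime] {K L : Type*} [Field K]
    [Field L] [Algebra K L] {x x' : WittVector p L} (w : WittVector p K)
    (h : x = x' + WittVector.map (algebraMap K L) w) :
    adjoin K (Set.range x.coeff) ≤ adjoin K (Set.range x'.coeff) := by
  rw [adjoin_le_iff]
  rintro _ ⟨n, rfl⟩
  set E := adjoin K (Set.range x'.coeff)
  let u : WittVector p E := WittVector.mk p fun n => ⟨x'.coeff n, subset_adjoin K _ ⟨n, rfl⟩⟩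
  have hx : x = WittVector.map (algebraMap E L) (u + WittVector.map (algebraMap K E) w) := by
    rw [h, map_add]
    congr 1
  rw [hx, WittVector.map_coeff]
  exact SetLike.coe_mem _

/-- A Frobenius-fixed Witt vector over an extension of fields of characteristic `p` is defined over
the base field. -/
theorem WittVector.exists_map_eq_of_frobenius_eq_self {p : ℕ} [Fact p.Prime] {K L : Type*} [Field K]
    [Field L] [CharP L p] [Algebra K L] {z : WittVector p L}
    (hz : WittVector.frobenius z = z) : ∃ w, WittVector.map (algebraMap K L) w = z := by
  have h (n : ℕ) : ∃ k : K, algebraMap K L k = z.coeff n := by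
    have hn : z.coeff n ^ p = z.coeff n := by
      rw [← WittVector.coeff_frobenius_charP, hz]
    have hbot := (Subfield.mem_bot_iff_pow_eq_self (F := L) (p := p)).2 hn
    exact (bot_le : ⊥ ≤ (algebraMap K L).fieldRange) hbot
  choose w hw using h
  exact ⟨WittVector.mk p w, WittVector.ext fun n => by simp [WittVector.map_coeff, hw]⟩

/-- Let `p` be a prime, `K` a field of characteristic `p` with separable closure
`K^sep`, and `a, b ∈ W(K)` with `a ≡ b (mod ℘ W(K))`.  If `x, x' ∈ W(K^sep)` satisfy `℘x = a` and
`℘x' = b` (images taken in `W(K^sep)`), then the intermediate fields of `K^sep/K` generated by all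
the coordinates of `x` resp. `x'` coincide.  In particular `K(℘⁻¹a)` depends only on the class of
`a` in `W(K)/℘W(K)`. -/
theorem wittVector_artinSchreier_field_well_defined (p : ℕ) [Fact p.Prime]
    (K Ksep : Type*) [Field K] [Field Ksep] [CharP K p]
    [Algebra K Ksep] [IsSepClosure K Ksep]
    (a b : WittVector p K)
    (hab : ∃ y : WittVector p K, a - b = WittVector.frobenius y - y)
    (x x' : WittVector p Ksep)
    (hx : WittVector.frobenius x - x = WittVector.map (algebraMap K Ksep) a)
    (hx' : WittVector.frobenius x' - x' = WittVector.map (algebraMap K Ksep) b) :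
    IntermediateField.adjoin K (Set.range x.coeff) =
      IntermediateField.adjoin K (Set.range x'.coeff) := by
  have : CharP Ksep p := charP_of_injective_algebraMap (algebraMap K Ksep).injective p
  obtain ⟨y, hy⟩ := hab
  have hfy : WittVector.frobenius (WittVector.map (algebraMap K Ksep) y) =
      WittVector.map (algebraMap K Ksep) (WittVector.frobenius y) := by
    ext n
    simp [WittVector.coeff_frobenius_charP, WittVector.map_coeff]
  have hmap := congrArg (WittVector.map (algebraMap K Ksep)) hy
  rw [map_sub, map_sub, ← hx, ← hx', ← hfy] at hmap
  have hz : WittVector.frobenius (x - x' - WittVector.map (algebraMap K Ksep) y) =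
      x - x' - WittVector.map (algebraMap K Ksep) y := by
    rw [map_sub, map_sub]
    linear_combination hmap
  obtain ⟨w, hw⟩ := WittVector.exists_map_eq_of_frobenius_eq_self (K := K) hz
  apply le_antisymm
  · apply WittVector.adjoin_coeff_le_of_eq_add_map (w + y)
    rw [map_add, hw]
    ring
  · apply WittVector.adjoin_coeff_le_of_eq_add_map (-(w + y))
    rw [map_neg, map_add, hw]
    ring
end

section
/- Let p be a prime, K a field of characteristic p with separable closure K^sep, a ∈ W(K), and x = (x_0, x_1, …) ∈ W(K^sep) with ℘x = a. Then the extension L = K(x_0, x_1, …) of K is Galois, and the map Gal(L/K) → W(K^sep) sending g to W(g)x − x (where W(g) is the coordinatewise action of g on Witt vectors) is an injective group homomorphism whose image is contained in the kernel of ℘ on W(K^sep), i.e., in the copy of ℤ_p = W(𝔽_p) inside W(K^sep). In particular Gal(L/K) is abelian. -/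
/-- The Witt vector `x ∈ W(K^sep)` viewed as a Witt vector over the intermediate field
`K(x_0, x_1, …)` generated by its coordinates. -/
noncomputable def wittAdjoinCoeff (p : ℕ) [Fact p.Prime] (K : Type*) {Ksep : Type*}
    [Field K] [Field Ksep] [Algebra K Ksep] (x : WittVector p Ksep) :
    WittVector p (IntermediateField.adjoin K (Set.range x.coeff)) :=
  WittVector.mk p fun i => ⟨x.coeff i, IntermediateField.subset_adjoin K _ ⟨i, rfl⟩⟩

/-- For `g ∈ Gal(K(x_0,x_1,…)/K)`, the Witt vector `W(g)x - x`, where `W(g)` is the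
coordinatewise action of `g` on Witt vectors. -/
noncomputable def artinSchreierWittCocycle (p : ℕ) [Fact p.Prime] (K : Type*) {Ksep : Type*}
    [Field K] [Field Ksep] [Algebra K Ksep] (x : WittVector p Ksep)
    (g : IntermediateField.adjoin K (Set.range x.coeff) ≃ₐ[K]
         IntermediateField.adjoin K (Set.range x.coeff)) :
    WittVector p (IntermediateField.adjoin K (Set.range x.coeff)) :=
  WittVector.map g.toAlgHom.toRingHom (wittAdjoinCoeff p K x) - wittAdjoinCoeff p K x

/-- The Witt vectors fixed by Frobenius over a domain of characteristic `p` come from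
`W(𝔽_p)`. -/
theorem WittVector.mem_range_map_zmod_of_frobenius_eq_self {p : ℕ} [Fact p.Prime] {L : Type*}
    [Field L] [CharP L p] {y : WittVector p L} (hy : WittVector.frobenius y = y) :
    y ∈ Set.range (WittVector.map (ZMod.castHom (dvd_refl p) L) :
        WittVector p (ZMod p) → WittVector p L) := by
  have h (n : ℕ) : ∃ c : ZMod p, ZMod.castHom (dvd_refl p) L c = y.coeff n := by
    have hn : y.coeff n ^ p = y.coeff n := by
      rw [← WittVector.coeff_frobenius_charP, hy]
    have hb := (Subfield.mem_bot_iff_pow_eq_self (F := L) (p := p)).2 hn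
    rwa [← ZMod.fieldRange_castHom_eq_bot p, RingHom.mem_fieldRange] at hb
  choose c hc using h
  exact ⟨WittVector.mk p c, WittVector.ext fun n => by simp [← hc n]⟩

/-- Ring homomorphisms between rings of characteristic `p` intertwine the images of
`W(𝔽_p)`. -/
theorem WittVector.map_map_zmod {p : ℕ} [Fact p.Prime] {L M : Type*} [CommRing L] [CommRing M]
    [CharP L p] [CharP M p] (f : L →+* M) (c : WittVector p (ZMod p)) :
    WittVector.map f (WittVector.map (ZMod.castHom (dvd_refl p) L) c) =
      WittVector.map (ZMod.castHom (dvd_refl p) M) c := by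
  ext n
  simp only [WittVector.map_coeff]
  exact DFunLike.congr_fun (Subsingleton.elim (f.comp (ZMod.castHom (dvd_refl p) L))
    (ZMod.castHom (dvd_refl p) M)) (c.coeff n)

/-- Frobenius commutes with functoriality of Witt vectors in characteristic `p`. -/
theorem WittVector.frobenius_map_of_charP {p : ℕ} [Fact p.Prime] {L M : Type*} [CommRing L]
    [CommRing M] [CharP L p] [CharP M p] (f : L →+* M) (y : WittVector p L) :
    WittVector.frobenius (WittVector.map f y) = WittVector.map f (WittVector.frobenius y) := by
  ext n
  simp [WittVector.coeff_frobenius_charP]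

/-- Two solutions `W(f)x`, `W(g)x` of the same Artin-Schreier-Witt equation differ by an element
of `W(𝔽_p)`. -/
theorem WittVector.map_sub_map_mem_range_zmod {p : ℕ} [Fact p.Prime] {K L M : Type*} [Field K]
    [Field L] [Field M] [CharP L p] [CharP M p] [Algebra K L] [Algebra K M]
    {a : WittVector p K} {x : WittVector p L}
    (hx : WittVector.frobenius x - x = WittVector.map (algebraMap K L) a) (f g : L →ₐ[K] M) :
    WittVector.map f.toRingHom x - WittVector.map g.toRingHom x ∈
      Set.range (WittVector.map (ZMod.castHom (dvd_refl p) M) :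
        WittVector p (ZMod p) → WittVector p M) := by
  have key (f : L →ₐ[K] M) : WittVector.frobenius (WittVector.map f.toRingHom x) =
      WittVector.map f.toRingHom x + WittVector.map (algebraMap K M) a := by
    rw [WittVector.frobenius_map_of_charP, eq_add_of_sub_eq' hx, map_add]
    congr 1
    ext n
    simp
  apply WittVector.mem_range_map_zmod_of_frobenius_eq_self
  rw [map_sub, key, key, add_sub_add_right_eq_sub]

section

variable {p : ℕ} [Fact p.Prime] {K Ksep : Type*} [Field K] [Field Ksep] [Algebra K Ksep]

theorem map_val_wittAdjoinCoeff (x : WittVector p Ksep) :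
    WittVector.map (IntermediateField.adjoin K (Set.range x.coeff)).val.toRingHom
      (wittAdjoinCoeff p K x) = x := by
  ext n
  simp [wittAdjoinCoeff]

theorem frobenius_wittAdjoinCoeff_sub [CharP Ksep p] {a : WittVector p K} {x : WittVector p Ksep}
    [CharP (IntermediateField.adjoin K (Set.range x.coeff)) p]
    (hx : WittVector.frobenius x - x = WittVector.map (algebraMap K Ksep) a) :
    WittVector.frobenius (wittAdjoinCoeff p K x) - wittAdjoinCoeff p K x =
      WittVector.map (algebraMap K (IntermediateField.adjoin K (Set.range x.coeff))) a := by
  apply WittVector.map_injective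
    (IntermediateField.adjoin K (Set.range x.coeff)).val.toRingHom (RingHom.injective _)
  rw [map_sub, ← WittVector.frobenius_map_of_charP, map_val_wittAdjoinCoeff, hx]
  ext n
  simp

theorem artinSchreierWittCocycle_injective (x : WittVector p Ksep) :
    Function.Injective (artinSchreierWittCocycle p K x) := by
  intro g h hgh
  have hgh' := sub_left_injective hgh
  have : g.toAlgHom = h.toAlgHom := by
    refine IntermediateField.adjoin_algHom_ext K ?_
    rintro _ ⟨n, rfl⟩
    simpa [wittAdjoinCoeff] using congrArg (fun y => y.coeff n) hgh'
  exact AlgEquiv.ext fun y => DFunLike.congr_fun this y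

theorem artinSchreierWittCocycle_mem_range_zmod [CharP Ksep p] {a : WittVector p K}
    {x : WittVector p Ksep} [CharP (IntermediateField.adjoin K (Set.range x.coeff)) p]
    (hx : WittVector.frobenius x - x = WittVector.map (algebraMap K Ksep) a)
    (g : IntermediateField.adjoin K (Set.range x.coeff) ≃ₐ[K]
      IntermediateField.adjoin K (Set.range x.coeff)) :
    artinSchreierWittCocycle p K x g ∈ Set.range (WittVector.map (ZMod.castHom (dvd_refl p)
      (IntermediateField.adjoin K (Set.range x.coeff)))) := by
  have h := WittVector.map_sub_map_mem_range_zmod (frobenius_wittAdjoinCoeff_sub hx) g.toAlgHom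
    (AlgHom.id K _)
  have hid : WittVector.map (AlgHom.id K _).toRingHom (wittAdjoinCoeff p K x) =
      wittAdjoinCoeff p K x := by
    ext n
    simp
  rwa [hid] at h

theorem artinSchreierWittCocycle_mul [CharP Ksep p] {a : WittVector p K}
    {x : WittVector p Ksep} [CharP (IntermediateField.adjoin K (Set.range x.coeff)) p]
    (hx : WittVector.frobenius x - x = WittVector.map (algebraMap K Ksep) a)
    (g h : IntermediateField.adjoin K (Set.range x.coeff) ≃ₐ[K]
      IntermediateField.adjoin K (Set.range x.coeff)) :
    artinSchreierWittCocycle p K x (g * h) =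
      artinSchreierWittCocycle p K x g + artinSchreierWittCocycle p K x h := by
  have hfix : WittVector.map g.toAlgHom.toRingHom (artinSchreierWittCocycle p K x h) =
      artinSchreierWittCocycle p K x h := by
    obtain ⟨c, hc⟩ := artinSchreierWittCocycle_mem_range_zmod hx h
    rw [← hc, WittVector.map_map_zmod]
  have hmul : WittVector.map (g * h).toAlgHom.toRingHom (wittAdjoinCoeff p K x) =
      WittVector.map g.toAlgHom.toRingHom
        (WittVector.map h.toAlgHom.toRingHom (wittAdjoinCoeff p K x)) := by
    ext n
    simp
  rw [← hfix]
  simp only [artinSchreierWittCocycle, map_sub, hmul]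
  abel

theorem isGalois_adjoin_range_coeff [CharP Ksep p] [IsGalois K Ksep] {a : WittVector p K}
    {x : WittVector p Ksep} [CharP (IntermediateField.adjoin K (Set.range x.coeff)) p]
    (hx : WittVector.frobenius x - x = WittVector.map (algebraMap K Ksep) a) :
    IsGalois K (IntermediateField.adjoin K (Set.range x.coeff)) := by
  have hnormal : Normal K (IntermediateField.adjoin K (Set.range x.coeff)) := by
    rw [IntermediateField.normal_iff_forall_map_le]
    intro σ
    rw [IntermediateField.adjoin_map, IntermediateField.adjoin_le_iff]
    rintro _ ⟨_, ⟨n, rfl⟩, rfl⟩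
    obtain ⟨c, hc⟩ := WittVector.map_sub_map_mem_range_zmod hx σ (AlgHom.id K Ksep)
    have hid : WittVector.map (AlgHom.id K Ksep).toRingHom x = x := by
      ext n
      simp
    rw [hid, eq_sub_iff_add_eq, ← WittVector.map_map_zmod
      (IntermediateField.adjoin K (Set.range x.coeff)).val.toRingHom] at hc
    have hn := congrArg (fun y => y.coeff n)
      ((congrArg _ (map_val_wittAdjoinCoeff (K := K) x)).trans hc)
    simp only [← map_add, WittVector.map_coeff] at hn
    change σ (x.coeff n) ∈ IntermediateField.adjoin K (Set.range x.coeff)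
    rw [show σ (x.coeff n) = _ from hn.symm]
    exact Subtype.property _
  exact ⟨⟩

end

/-- Let `p` be a prime, `K` a field of characteristic `p` with separable closure
`K^sep`, `a ∈ W(K)` and `x ∈ W(K^sep)` with `℘x = a`.  Then `L = K(x_0, x_1, …)` is Galois over
`K`, and the map `Gal(L/K) → W(K^sep)`, `g ↦ W(g)x - x`, is an injective group homomorphism whose
image lies in the kernel of `℘` on `W(K^sep)`, i.e. in the copy of `ℤ_p = W(𝔽_p)` inside
`W(K^sep)`.  In particular `Gal(L/K)` is abelian. -/
theorem artinSchreierWitt_galois (p : ℕ) [Fact p.Prime]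
    (K Ksep : Type*) [Field K] [Field Ksep] [CharP K p] [CharP Ksep p]
    [Algebra K Ksep] [IsSepClosure K Ksep]
    (a : WittVector p K) (x : WittVector p Ksep)
    (hx : WittVector.frobenius x - x = WittVector.map (algebraMap K Ksep) a) :
    IsGalois K (IntermediateField.adjoin K (Set.range x.coeff)) ∧
    Function.Injective (artinSchreierWittCocycle p K x) ∧
    (∀ g h, artinSchreierWittCocycle p K x (g * h) =
      artinSchreierWittCocycle p K x g + artinSchreierWittCocycle p K x h) ∧
    (∀ g, WittVector.map (IntermediateField.adjoin K (Set.range x.coeff)).val.toRingHom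
        (artinSchreierWittCocycle p K x g) ∈
      Set.range (WittVector.map (ZMod.castHom (dvd_refl p) Ksep) :
        WittVector p (ZMod p) → WittVector p Ksep)) ∧
    (∀ g h : IntermediateField.adjoin K (Set.range x.coeff) ≃ₐ[K]
        IntermediateField.adjoin K (Set.range x.coeff), g * h = h * g) := by
  have : CharP (IntermediateField.adjoin K (Set.range x.coeff)) p :=
    charP_of_injective_algebraMap (algebraMap K _).injective p
  have : IsGalois K Ksep := IsSepClosure.isGalois
  refine ⟨isGalois_adjoin_range_coeff hx, artinSchreierWittCocycle_injective x,
    artinSchreierWittCocycle_mul hx, fun g => ?_, fun g h => ?_⟩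
  · obtain ⟨c, hc⟩ := artinSchreierWittCocycle_mem_range_zmod hx g
    exact ⟨c, by rw [← hc, WittVector.map_map_zmod]⟩
  · apply artinSchreierWittCocycle_injective x
    rw [artinSchreierWittCocycle_mul hx, artinSchreierWittCocycle_mul hx, add_comm]
end

section
/- Let p be a prime, K a field of characteristic p with separable closure K^sep, and a = (a_0, a_1, …) ∈ W(K) such that a_0 is not of the form t^p − t for any t ∈ K. Let x = (x_0, x_1, …) ∈ W(K^sep) satisfy ℘x = a, and for n ≥ 1 set K_n = K(x_0, x_1, …, x_{n−1}). Then K_n/K is a Galois extension whose Galois group is cyclic of order p^n. -/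
open WittVector in
/-- An element of `W(L)` fixed by Frobenius comes from `W(𝔽_p)`. -/
theorem WittVector.exists_map_zmod_of_frobenius_eq_self {p : ℕ} [Fact p.Prime] {L : Type*} [Field L]
    [CharP L p] [Algebra (ZMod p) L] {y : WittVector p L} (hy : frobenius y = y) :
    ∃ z : WittVector p (ZMod p), map (algebraMap (ZMod p) L) z = y := by
  have h (i : ℕ) : ∃ c : ZMod p, algebraMap (ZMod p) L c = y.coeff i := by
    have hi : y.coeff i ∈ (⊥ : Subfield L) := by
      rw [Subfield.mem_bot_iff_pow_eq_self L p, ← coeff_frobenius_charP, hy]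
    exact (bot_le : ⊥ ≤ (algebraMap (ZMod p) L).fieldRange) hi
  choose c hc using h
  exact ⟨WittVector.mk p c, WittVector.ext fun i => by simp [map_coeff, hc]⟩

theorem WittVector.toZModPow_eq_zero_iff {p : ℕ} [Fact p.Prime] {n : ℕ}
    (z : WittVector p (ZMod p)) : toZModPow p n z = 0 ↔ ∀ i < n, z.coeff i = 0 := by
  rw [← mem_ker_truncate, RingHom.mem_ker]
  exact (TruncatedWittVector.zmodEquivTrunc p n).symm.map_eq_zero_iff

open WittVector in
/-- If `℘x` has coefficients in `K`, then the `p`-adic integer `σx - x` depends additively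
on the `K`-automorphism `σ`. -/
theorem WittVector.exists_artinSchreierWitt_cocycle {p : ℕ} [Fact p.Prime] {K L : Type*} [Field K]
    [Field L] [CharP L p] [Algebra K L] [Algebra (ZMod p) L] (a : WittVector p K)
    (x : WittVector p L) (hx : frobenius x - x = map (algebraMap K L) a) :
    ∃ c : Gal(L/K) →* Multiplicative (WittVector p (ZMod p)), ∀ σ : Gal(L/K),
      map (algebraMap (ZMod p) L) (c σ).toAdd = map (σ : L →+* L) x - x := by
  have hfix (σ : Gal(L/K)) : frobenius (map (σ : L →+* L) x - x) = map (σ : L →+* L) x - x := by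
    have h₁ : map (σ : L →+* L) (map (algebraMap K L) a) = map (algebraMap K L) a :=
      WittVector.ext fun i => by simp [map_coeff]
    have h₂ : frobenius (map (σ : L →+* L) x) = map (σ : L →+* L) (frobenius x) :=
      WittVector.ext fun i => by simp [map_coeff, coeff_frobenius_charP]
    rw [← hx, map_sub, ← h₂] at h₁
    rw [map_sub]
    linear_combination h₁
  choose z hz using fun σ => exists_map_zmod_of_frobenius_eq_self (hfix σ)
  have hinj := map_injective (p := p) _ (algebraMap (ZMod p) L).injective
  have hmap (σ : Gal(L/K)) (w : WittVector p (ZMod p)) :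
      map (σ : L →+* L) (map (algebraMap (ZMod p) L) w) = map (algebraMap (ZMod p) L) w :=
    WittVector.ext fun i => by
      simp only [map_coeff]
      exact RingHom.congr_fun (Subsingleton.elim
        ((σ : L →+* L).comp (algebraMap (ZMod p) L)) (algebraMap (ZMod p) L)) _
  refine ⟨MonoidHom.mk' (fun σ => Multiplicative.ofAdd (z σ)) fun σ τ => ?_, hz⟩
  rw [← ofAdd_add]
  refine congrArg _ (hinj ?_)
  have hcomp : map ((σ * τ : Gal(L/K)) : L →+* L) x = map (σ : L →+* L) (map (τ : L →+* L) x) :=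
    WittVector.ext fun i => by simp [map_coeff]
  have h := hmap σ (z τ)
  rw [hz, map_sub] at h
  rw [map_add, hz, hz, hz, hcomp]
  linear_combination h

/-- A homomorphism to `ℤ/m` taking a unit value is surjective. -/
theorem MonoidHom.surjective_of_isUnit_zmod {G : Type*} [Group G] {m : ℕ}
    (f : G →* Multiplicative (ZMod m)) {g : G} (hg : IsUnit (f g).toAdd) :
    Function.Surjective f := by
  intro y
  obtain ⟨u, hu⟩ := hg
  obtain ⟨k, hk⟩ := ZMod.intCast_surjective (y.toAdd * ((u⁻¹ : (ZMod m)ˣ) : ZMod m))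
  refine ⟨g ^ k, Multiplicative.toAdd.injective ?_⟩
  rw [map_zpow, toAdd_zpow, ← hu, zsmul_eq_mul, hk, mul_assoc, Units.inv_mul, mul_one]

/-- A surjection from a Galois group whose kernel is the fixing subgroup of `E` identifies its
target with the Galois group of `E`. -/
theorem InfiniteGalois.isGalois_and_nonempty_mulEquiv_of_ker_eq {K L H : Type*} [Field K] [Field L]
    [Algebra K L] [IsGalois K L] [Group H] (E : IntermediateField K L) (f : Gal(L/K) →* H)
    (hf : Function.Surjective f) (hker : f.ker = E.fixingSubgroup) :
    IsGalois K E ∧ Nonempty (Gal(E/K) ≃* H) := by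
  have hE : IsGalois K E := by
    rw [← InfiniteGalois.normal_iff_isGalois, ← hker]
    infer_instance
  refine ⟨hE, ⟨?_⟩⟩
  have h : (AlgEquiv.restrictNormalHom (F := K) (K₁ := L) E).ker = f.ker := by
    rw [hker, IntermediateField.restrictNormalHom_ker]
  exact (QuotientGroup.quotientKerEquivOfSurjective _
      (AlgEquiv.restrictNormalHom_surjective (F := K) (K₁ := E) L)).symm.trans
    ((QuotientGroup.quotientMulEquivOfEq h).trans
      (QuotientGroup.quotientKerEquivOfSurjective f hf))


/-- Let `p` be a prime, `K` a field of characteristic `p` with separable closure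
`K^sep`, and `a = (a_0, a_1, …) ∈ W(K)` with `a_0` not of the form `t^p - t` for `t ∈ K`.  Let
`x = (x_0, x_1, …) ∈ W(K^sep)` satisfy `℘x = a`, and for `n ≥ 1` let
`K_n = K(x_0, …, x_{n-1})`.  Then `K_n/K` is Galois with Galois group cyclic of order `p^n`. -/
theorem artinSchreierWitt_cyclic_tower (p : ℕ) [Fact p.Prime]
    (K Ksep : Type*) [Field K] [Field Ksep] [CharP K p]
    [Algebra K Ksep] [IsSepClosure K Ksep]
    (a : WittVector p K) (ha : ¬ ∃ t : K, t ^ p - t = a.coeff 0)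
    (x : WittVector p Ksep)
    (hx : WittVector.frobenius x - x = WittVector.map (algebraMap K Ksep) a)
    (n : ℕ) (hn : 1 ≤ n) :
    IsGalois K (IntermediateField.adjoin K (x.coeff '' {i | i < n})) ∧
    IsCyclic ((IntermediateField.adjoin K (x.coeff '' {i | i < n})) ≃ₐ[K]
      (IntermediateField.adjoin K (x.coeff '' {i | i < n}))) ∧
    Nat.card ((IntermediateField.adjoin K (x.coeff '' {i | i < n})) ≃ₐ[K]
      (IntermediateField.adjoin K (x.coeff '' {i | i < n}))) = p ^ n := by
  have hchar : CharP Ksep p := charP_of_injective_algebraMap (algebraMap K Ksep).injective p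
  let _ : Algebra (ZMod p) Ksep := ZMod.algebra Ksep p
  obtain ⟨c, hc⟩ := WittVector.exists_artinSchreierWitt_cocycle a x hx
  have hcoeff (σ : Gal(Ksep/K)) (m : ℕ) :
      (∀ i < m, (c σ).toAdd.coeff i = 0) ↔ ∀ i < m, σ (x.coeff i) = x.coeff i := by
    have h : WittVector.map (algebraMap (ZMod p) Ksep) (c σ).toAdd ∈
          RingHom.ker (WittVector.truncate (p := p) m) ↔
        WittVector.truncate m (WittVector.map (σ : Ksep →+* Ksep) x) =
          WittVector.truncate m x := by
      rw [hc, RingHom.mem_ker, map_sub, sub_eq_zero]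
    rw [WittVector.mem_ker_truncate, TruncatedWittVector.ext_iff] at h
    simpa [WittVector.map_coeff, WittVector.coeff_truncate, Fin.forall_iff] using h
  let f : Gal(Ksep/K) →* Multiplicative (ZMod (p ^ n)) :=
    (AddMonoidHom.toMultiplicative (WittVector.toZModPow p n).toAddMonoidHom).comp c
  have hf (σ : Gal(Ksep/K)) : (f σ).toAdd = WittVector.toZModPow p n (c σ).toAdd := rfl
  have hker : f.ker = (IntermediateField.adjoin K (x.coeff '' {i | i < n})).fixingSubgroup := by
    ext σ
    rw [MonoidHom.mem_ker, ← toAdd_eq_zero, hf, WittVector.toZModPow_eq_zero_iff, hcoeff,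
      ← Subgroup.zpowers_le, ← IntermediateField.le_iff_le, IntermediateField.adjoin_le_iff,
      Set.image_subset_iff]
    refine forall₂_congr fun i _ => ?_
    refine ⟨fun h => ?_, fun h => h ⟨σ, Subgroup.mem_zpowers σ⟩⟩
    rintro ⟨τ, hτ⟩
    have hσ : σ ∈ MulAction.stabilizer Gal(Ksep/K) (x.coeff i) := h
    exact (Subgroup.zpowers_le.mpr hσ) hτ
  have hsurj : Function.Surjective f := by
    obtain ⟨σ, hσ⟩ : ∃ σ : Gal(Ksep/K), σ (x.coeff 0) ≠ x.coeff 0 := by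
      by_contra! h
      obtain ⟨t, ht⟩ := (InfiniteGalois.mem_range_algebraMap_iff_fixed _).mpr h
      refine ha ⟨t, (algebraMap K Ksep).injective ?_⟩
      have h₀ := congrArg WittVector.constantCoeff hx
      simp only [map_sub, WittVector.constantCoeff_apply, WittVector.map_coeff,
        WittVector.coeff_frobenius_charP] at h₀
      rw [map_sub, map_pow, ht, h₀]
    have hunit : IsUnit (c σ).toAdd := by
      refine WittVector.isUnit_of_coeff_zero_ne_zero _ fun h₀ => hσ ?_
      exact (hcoeff σ 1).mp (by simpa using h₀) 0 one_pos
    exact f.surjective_of_isUnit_zmod (g := σ) (hunit.map (WittVector.toZModPow p n))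
  obtain ⟨hgal, ⟨e⟩⟩ := InfiniteGalois.isGalois_and_nonempty_mulEquiv_of_ker_eq _ f hsurj hker
  refine ⟨hgal, e.isCyclic.mpr inferInstance, ?_⟩
  rw [Nat.card_congr e.toEquiv, Nat.card_congr Multiplicative.toAdd, Nat.card_zmod]
end

section
/- Let p be a prime, k a perfect field of characteristic p, and K = k((T)). Then for every f ∈ K there exist g ∈ K, b ∈ k, and a finitely supported family (a_i) of elements of k indexed by positive integers i coprime to p, such that f = (g^p − g) + b + ∑_i a_i T^{−i}. -/
/-- Over a commutative ring of characteristic `p > 1`, every power series without constant term has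
the form `g ^ p - g`. -/
theorem PowerSeries.exists_pow_sub_self_eq {R : Type*} [CommRing R] (p : ℕ) [CharP R p]
    (hp : 1 < p) (h : PowerSeries R) (h0 : PowerSeries.constantCoeff h = 0) :
    ∃ g : PowerSeries R, g ^ p - g = h := by
  have hpz : (p : PowerSeries R) = 0 := by
    rw [← map_natCast (PowerSeries.C (R := R)), CharP.cast_eq_zero, map_zero]
  have hmonic : (Polynomial.X ^ p - (Polynomial.X + Polynomial.C h)).Monic := by
    nontriviality R
    refine (Polynomial.monic_X_pow p).sub_of_left ?_
    rw [Polynomial.degree_X_pow, Polynomial.degree_X_add_C]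
    exact_mod_cast hp
  obtain ⟨g, hg, -⟩ := HenselianRing.is_henselian
    (I := Ideal.span {(PowerSeries.X : PowerSeries R)}) _ hmonic 0
    (by
      rw [Ideal.mem_span_singleton, PowerSeries.X_dvd_iff]
      simp [h0, (zero_lt_one.trans hp).ne'])
    (by
      simp only [Polynomial.derivative_sub, Polynomial.derivative_X_pow, Polynomial.derivative_add,
        Polynomial.derivative_X, Polynomial.derivative_C, hpz]
      simp)
  refine ⟨g, ?_⟩
  have : g ^ p - (g + h) = 0 := by simpa [Polynomial.IsRoot.def] using hg
  linear_combination this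

namespace LaurentSeries

variable {k : Type*} [Field k]

/-- `f` is congruent modulo `g ↦ g ^ p - g` to a constant plus a polar part supported in degrees
prime to `p`. -/
def IsArtinSchreierReducible (p : ℕ) (f : LaurentSeries k) : Prop :=
  ∃ (g : LaurentSeries k) (b : k) (a : ℕ →₀ k),
    (∀ i ∈ a.support, 0 < i ∧ ¬ p ∣ i) ∧
    f = (g ^ p - g) + HahnSeries.C b + a.sum fun i c => HahnSeries.single (-(i : ℤ)) c

namespace IsArtinSchreierReducible

variable {p : ℕ}

theorem pow_sub_self (g : LaurentSeries k) : IsArtinSchreierReducible p (g ^ p - g) :=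
  ⟨g, 0, 0, by simp, by simp⟩

variable [Fact p.Prime]

theorem const (b : k) : IsArtinSchreierReducible p (HahnSeries.C b) :=
  ⟨0, b, 0, by simp, by simp [(Fact.out : p.Prime).ne_zero]⟩

theorem add [CharP k p] {f₁ f₂ : LaurentSeries k} (h₁ : IsArtinSchreierReducible p f₁)
    (h₂ : IsArtinSchreierReducible p f₂) : IsArtinSchreierReducible p (f₁ + f₂) := by
  classical
  obtain ⟨g₁, b₁, a₁, ha₁, rfl⟩ := h₁
  obtain ⟨g₂, b₂, a₂, ha₂, rfl⟩ := h₂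
  have : CharP (LaurentSeries k) p :=
    charP_of_injective_ringHom (f := (HahnSeries.C : k →+* LaurentSeries k))
      HahnSeries.C_injective p
  refine ⟨g₁ + g₂, b₁ + b₂, a₁ + a₂, fun i hi => ?_, ?_⟩
  · exact (Finset.mem_union.mp (Finsupp.support_add hi)).elim (ha₁ i) (ha₂ i)
  · rw [add_pow_char, map_add, Finsupp.sum_add_index' (by simp) (by simp)]
    ring

theorem single_neg [CharP k p] (hperf : Function.Surjective fun x : k => x ^ p)
    (n : ℕ) (hn : 0 < n) (c : k) :
    IsArtinSchreierReducible p (HahnSeries.single (-(n : ℤ)) c) := by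
  have hp : p.Prime := Fact.out
  induction n using Nat.strong_induction_on generalizing c with
  | _ n ih =>
    by_cases hdvd : p ∣ n
    · obtain ⟨m, rfl⟩ := hdvd
      obtain ⟨d, rfl⟩ := hperf c
      have hm : 0 < m := Nat.pos_of_mul_pos_left hn
      have hpow : (HahnSeries.single (-(m : ℤ)) d) ^ p
          = HahnSeries.single (-((p * m : ℕ) : ℤ)) (d ^ p) := by
        rw [HahnSeries.single_pow]
        congr 2
        simp
      have := (pow_sub_self (p := p) (HahnSeries.single (-(m : ℤ)) d)).add
        (ih m (lt_mul_of_one_lt_left hm hp.one_lt) hm d)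
      rwa [sub_add_cancel, hpow] at this
    · refine ⟨0, 0, Finsupp.single n c, fun i hi => ?_, ?_⟩
      · obtain rfl := Finset.mem_singleton.mp (Finsupp.support_single_subset hi)
        exact ⟨hn, hdvd⟩
      · simp [hp.ne_zero]

theorem ofPowerSeries [CharP k p] (h : PowerSeries k) :
    IsArtinSchreierReducible p (HahnSeries.ofPowerSeries ℤ k h) := by
  obtain ⟨g, hg⟩ := PowerSeries.exists_pow_sub_self_eq p (Fact.out : p.Prime).one_lt
    (h - PowerSeries.C (PowerSeries.constantCoeff h)) (by simp)
  have := (pow_sub_self (p := p) (HahnSeries.ofPowerSeries ℤ k g)).add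
    (const (PowerSeries.constantCoeff h))
  rwa [← map_pow, ← map_sub, hg, ← HahnSeries.ofPowerSeries_C, ← map_add, sub_add_cancel] at this

theorem single_neg_mul_ofPowerSeries [CharP k p] (hperf : Function.Surjective fun x : k => x ^ p)
    (n : ℕ) (h : PowerSeries k) :
    IsArtinSchreierReducible p
      (HahnSeries.single (-(n : ℤ)) 1 * HahnSeries.ofPowerSeries ℤ k h) := by
  induction n generalizing h with
  | zero => simpa using ofPowerSeries h
  | succ n ih =>
    rw [PowerSeries.eq_X_mul_shift_add_const h, map_add, map_mul, HahnSeries.ofPowerSeries_X,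
      HahnSeries.ofPowerSeries_C, mul_add, ← mul_assoc, HahnSeries.single_mul_single,
      HahnSeries.C_apply, HahnSeries.single_mul_single, mul_one, one_mul, add_zero]
    have hdeg : -((n + 1 : ℕ) : ℤ) + 1 = -(n : ℤ) := by push_cast; ring
    rw [hdeg]
    exact (ih _).add (single_neg hperf _ n.succ_pos _)

end IsArtinSchreierReducible

theorem isArtinSchreierReducible (p : ℕ) [Fact p.Prime] [CharP k p]
    (hperf : Function.Surjective fun x : k => x ^ p) (f : LaurentSeries k) :
    IsArtinSchreierReducible p f := by
  rw [← single_order_mul_powerSeriesPart f]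
  obtain ⟨n, hn | hn⟩ := f.order.eq_nat_or_neg
  · rw [single_order_mul_powerSeriesPart, ← X_order_mul_powerSeriesPart hn.symm]
    exact .ofPowerSeries _
  · rw [hn]
    exact .single_neg_mul_ofPowerSeries hperf n _

end LaurentSeries


/-- Let `p` be a prime, `k` a perfect field of characteristic `p` (i.e.
`x ↦ x^p` is surjective on `k`), and `K = k((T))`.  Every `f ∈ K` can be written as
`f = (g^p - g) + b + ∑_i a_i T^{-i}` with `g ∈ K`, `b ∈ k`, and `(a_i)` a finitely supported
family of elements of `k` indexed by positive integers `i` coprime to `p`. -/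
theorem laurentSeries_artinSchreier_reduction (p : ℕ) [Fact p.Prime]
    (k : Type*) [Field k] [CharP k p]
    (hperf : Function.Surjective fun x : k => x ^ p)
    (f : LaurentSeries k) :
    ∃ (g : LaurentSeries k) (b : k) (a : ℕ →₀ k),
      (∀ i ∈ a.support, 0 < i ∧ ¬ p ∣ i) ∧
      f = (g ^ p - g) + HahnSeries.C b
        + a.sum fun i c => HahnSeries.single (-(i : ℤ)) c :=
  LaurentSeries.isArtinSchreierReducible p hperf f
end

section
/- Let p be a prime, k a field of characteristic p, and K = k((T)). Suppose b ∈ k and (a_i) is a finitely supported family of elements of k indexed by positive integers i coprime to p, and suppose b + ∑_i a_i T^{−i} = g^p − g for some g ∈ K. Then a_i = 0 for all i, and b = c^p − c for some c ∈ k. -/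
/-- The coefficient of `x ^ n` in degree `n • x.order` is the `n`-th power of the coefficient of
`x` in degree `x.order`. -/
theorem HahnSeries.coeff_pow_nsmul_order {Γ R : Type*} [AddCommMonoid Γ] [LinearOrder Γ]
    [IsOrderedCancelAddMonoid Γ] [Semiring R] [NoZeroDivisors R]
    (x : HahnSeries Γ R) (n : ℕ) :
    (x ^ n).coeff (n • x.order) = x.coeff x.order ^ n := by
  induction n with
  | zero => simp
  | succ n ih =>
    have := HahnSeries.coeff_mul_order_add_order (x ^ n) x
    rw [HahnSeries.leadingCoeff_eq, HahnSeries.leadingCoeff_eq, HahnSeries.order_pow, ih] at this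
    rw [pow_succ, succ_nsmul, this, pow_succ]

/-- Let `p` be a prime, `k` a field of characteristic `p`, `K = k((T))`.
If `b ∈ k`, `(a_i)` is a finitely supported family of elements of `k` indexed by positive
integers `i` coprime to `p`, and `b + ∑_i a_i T^{-i} = g^p - g` for some `g ∈ K`, then all
`a_i = 0` and `b = c^p - c` for some `c ∈ k`. -/
theorem laurentSeries_artinSchreier_uniqueness (p : ℕ) [Fact p.Prime]
    (k : Type*) [Field k] [CharP k p]
    (b : k) (a : ℕ →₀ k) (ha : ∀ i ∈ a.support, 0 < i ∧ ¬ p ∣ i)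
    (g : LaurentSeries k)
    (h : HahnSeries.C b + (a.sum fun i c => HahnSeries.single (-(i : ℤ)) c)
        = g ^ p - g) :
    a = 0 ∧ ∃ c : k, c ^ p - c = b := by
  have hp : 1 < p := (Fact.out : p.Prime).one_lt
  have hp0 : p ≠ 0 := by omega
  have hcoeff (n : ℕ) : (if n = 0 then b else 0) + a n =
      (g ^ p).coeff (-(n : ℤ)) - g.coeff (-(n : ℤ)) := by
    rw [← HahnSeries.coeff_sub, ← h, HahnSeries.coeff_add, Finsupp.sum, HahnSeries.coeff_sum,
      HahnSeries.C_apply, HahnSeries.coeff_single]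
    simp only [HahnSeries.coeff_single, neg_inj, Nat.cast_inj, neg_eq_zero, Nat.cast_eq_zero]
    rw [Finset.sum_ite_eq]
    simp +contextual [eq_comm]
  have ha0 (n : ℕ) (hn : n = 0 ∨ p ∣ n) : a n = 0 := by
    by_contra hne
    have := ha n (Finsupp.mem_support_iff.mpr hne)
    omega
  have hord : 0 ≤ g.order := by
    by_contra! hneg
    obtain ⟨m, hm⟩ := Int.eq_ofNat_of_zero_le (a := -g.order) (by omega)
    have hm0 : 0 < m := by omega
    have hgm : g.order = -(m : ℤ) := by omega
    have hg : g ≠ 0 := by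
      rintro rfl
      simp at hneg
    have key := hcoeff (p * m)
    have hlt : -((p * m : ℕ) : ℤ) < g.order := by
      rw [hgm]
      push_cast
      nlinarith
    have hdeg : -((p * m : ℕ) : ℤ) = p • g.order := by
      rw [hgm]
      simp
    rw [ha0 _ (Or.inr (dvd_mul_right p m)), if_neg (by positivity),
      HahnSeries.coeff_eq_zero_of_lt_order hlt, hdeg, HahnSeries.coeff_pow_nsmul_order] at key
    exact pow_ne_zero p (HahnSeries.coeff_order_eq_zero.not.mpr hg) (by simpa using key.symm)
  constructor
  · ext n
    rcases Nat.eq_zero_or_pos n with hn | hn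
    · exact ha0 n (Or.inl hn)
    · have key := hcoeff n
      rw [if_neg hn.ne', HahnSeries.coeff_eq_zero_of_lt_order (x := g) (by omega),
        HahnSeries.coeff_eq_zero_of_lt_order (x := g ^ p)] at key
      · simpa using key
      · rw [HahnSeries.order_pow, nsmul_eq_mul]
        have : 0 ≤ (p : ℤ) * g.order := by positivity
        omega
  · refine ⟨g.coeff 0, ?_⟩
    have key := hcoeff 0
    rw [ha0 0 (Or.inl rfl)] at key
    simp only [if_true, add_zero, Nat.cast_zero, neg_zero] at key
    rw [key]
    congr 1
    rcases hord.eq_or_lt with h0 | hpos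
    · have := HahnSeries.coeff_pow_nsmul_order g p
      rw [← h0, smul_zero] at this
      exact this.symm
    · rw [HahnSeries.coeff_eq_zero_of_lt_order hpos, zero_pow hp0,
        HahnSeries.coeff_eq_zero_of_lt_order]
      rw [HahnSeries.order_pow, nsmul_eq_mul]
      positivity
end

section
/- Let p be a prime and k a perfect field of characteristic p. Then for every polynomial f ∈ k[X] there exist g ∈ k[X], b ∈ k, and a finitely supported family (b_j) of elements of k indexed by positive integers j coprime to p, such that f = (g^p − g) + b + ∑_j b_j X^j. -/
open Polynomial in
/-- The additive monoid of polynomials of the form `(g ^ p - g) + b + ∑ j, a j * X ^ j`, where the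
sum runs over finitely many positive integers `j` not divisible by `p`. -/
noncomputable def artinSchreierReducible (p : ℕ) [Fact p.Prime] (k : Type*) [Field k] [CharP k p] :
    AddSubmonoid k[X] where
  carrier := {f | ∃ (g : k[X]) (b : k) (a : ℕ →₀ k),
    (∀ j ∈ a.support, 0 < j ∧ ¬ p ∣ j) ∧
      f = (g ^ p - g) + C b + a.sum fun j c => C c * X ^ j}
  zero_mem' := ⟨0, 0, 0, by simp, by simp [(Fact.out : p.Prime).ne_zero]⟩
  add_mem' := by
    classical
    rintro _ _ ⟨g, b, a, ha, rfl⟩ ⟨g', b', a', ha', rfl⟩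
    refine ⟨g + g', b + b', a + a', fun j hj => ?_, ?_⟩
    · exact (Finset.mem_union.mp (Finsupp.support_add hj)).elim (ha j) (ha' j)
    · rw [Finsupp.sum_add_index' (by simp) (by simp [add_mul]), add_pow_char, C_add]
      ring

open Polynomial in
theorem monomial_mem_artinSchreierReducible (p : ℕ) [Fact p.Prime] (k : Type*) [Field k]
    [CharP k p] (hperf : Function.Surjective fun x : k => x ^ p) (n : ℕ) (c : k) :
    monomial n c ∈ artinSchreierReducible p k := by
  have hp : p.Prime := Fact.out
  induction n using Nat.strong_induction_on generalizing c with
  | _ n ih =>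
    rcases Nat.eq_zero_or_pos n with rfl | hn
    · exact ⟨0, c, 0, by simp, by simp [hp.ne_zero]⟩
    by_cases hpn : p ∣ n
    · obtain ⟨m, rfl⟩ := hpn
      obtain ⟨d, rfl⟩ := hperf c
      have hm : 0 < m := Nat.pos_of_mul_pos_left hn
      have hpow : monomial (p * m) (d ^ p) =
          ((monomial m d) ^ p - monomial m d) + monomial m d := by
        rw [monomial_pow, mul_comm m p, sub_add_cancel]
      change monomial (p * m) (d ^ p) ∈ _
      rw [hpow]
      exact add_mem ⟨monomial m d, 0, 0, by simp, by simp⟩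
        (ih m (lt_mul_of_one_lt_left hm hp.one_lt) d)
    · refine ⟨0, 0, Finsupp.single n c, fun j hj => ?_, ?_⟩
      · obtain rfl := Finset.mem_singleton.mp (Finsupp.support_single_subset hj)
        exact ⟨hn, hpn⟩
      · simp [hp.ne_zero, C_mul_X_pow_eq_monomial]

/-- Let `p` be a prime and `k` a perfect field of characteristic `p` (i.e.
`x ↦ x^p` is surjective on `k`).  Every polynomial `f ∈ k[X]` can be written as
`f = (g^p - g) + b + ∑_j b_j X^j` with `g ∈ k[X]`, `b ∈ k`, and `(b_j)` a finitely supported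
family of elements of `k` indexed by positive integers `j` coprime to `p`. -/
theorem polynomial_artinSchreier_reduction (p : ℕ) [Fact p.Prime]
    (k : Type*) [Field k] [CharP k p]
    (hperf : Function.Surjective fun x : k => x ^ p)
    (f : Polynomial k) :
    ∃ (g : Polynomial k) (b : k) (a : ℕ →₀ k),
      (∀ j ∈ a.support, 0 < j ∧ ¬ p ∣ j) ∧
      f = (g ^ p - g) + Polynomial.C b
        + a.sum fun j c => Polynomial.C c * Polynomial.X ^ j := by
  change f ∈ artinSchreierReducible p k
  induction f using Polynomial.induction_on' with
  | add f g hf hg => exact add_mem hf hg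
  | monomial n c => exact monomial_mem_artinSchreierReducible p k hperf n c
end

section
/- Let p be a prime, k a field of characteristic p, and K = k(X) the field of rational functions over k. Suppose b ∈ k and (b_j) is a finitely supported family of elements of k indexed by positive integers j coprime to p, and suppose b + ∑_j b_j X^j = h^p − h for some h ∈ K. Then b_j = 0 for all j, and b = c^p − c for some c ∈ k. -/
open Polynomial in
/-- An Artin–Schreier root of an element of an integrally closed domain, taken in its fraction
field, already lies in the domain. -/
theorem IsIntegrallyClosed.exists_algebraMap_eq_of_pow_sub_self {R K : Type*} [CommRing R]
    [IsDomain R] [IsIntegrallyClosed R] [Field K] [Algebra R K] [IsFractionRing R K] {n : ℕ}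
    (hn : 1 < n) {f : R} {x : K} (hx : algebraMap R K f = x ^ n - x) :
    ∃ y : R, algebraMap R K y = x := by
  refine IsIntegrallyClosed.algebraMap_eq_of_integral ⟨X ^ n - (X + C f), ?_, ?_⟩
  · refine monic_X_pow_sub ?_
    rw [degree_X_add_C]
    exact_mod_cast hn
  · simp [hx]

theorem Polynomial.natDegree_pow_sub_self {R : Type*} [CommRing R] [NoZeroDivisors R] {n : ℕ}
    (hn : 1 < n) (q : Polynomial R) : (q ^ n - q).natDegree = n * q.natDegree := by
  rcases Nat.eq_zero_or_pos q.natDegree with hq | hq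
  · rw [eq_C_of_natDegree_eq_zero hq, ← C_pow, ← C_sub]
    simp
  · rw [natDegree_sub_eq_left_of_natDegree_lt, natDegree_pow]
    rw [natDegree_pow]
    nlinarith

theorem Polynomial.coeff_finsuppSum_C_mul_X_pow {R : Type*} [Semiring R] (a : ℕ →₀ R) (n : ℕ) :
    (a.sum fun j c => C c * X ^ j).coeff n = a n := by
  simp +contextual [Finsupp.sum, finsetSum_coeff, coeff_C_mul, coeff_X_pow]

/-- Let `p` be a prime, `k` a field of characteristic `p`, and `K = k(X)` the
field of rational functions.  If `b ∈ k`, `(b_j)` is a finitely supported family of elements of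
`k` indexed by positive integers `j` coprime to `p`, and `b + ∑_j b_j X^j = h^p - h` for some
`h ∈ K`, then all `b_j = 0` and `b = c^p - c` for some `c ∈ k`. -/
theorem ratFunc_artinSchreier_uniqueness (p : ℕ) [Fact p.Prime]
    (k : Type*) [Field k] [CharP k p]
    (b : k) (a : ℕ →₀ k) (ha : ∀ j ∈ a.support, 0 < j ∧ ¬ p ∣ j)
    (h : RatFunc k)
    (heq : algebraMap (Polynomial k) (RatFunc k)
        (Polynomial.C b + a.sum fun j c => Polynomial.C c * Polynomial.X ^ j)
      = h ^ p - h) :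
    a = 0 ∧ ∃ c : k, c ^ p - c = b := by
  have hp : 1 < p := (Fact.out : p.Prime).one_lt
  obtain ⟨q, rfl⟩ := IsIntegrallyClosed.exists_algebraMap_eq_of_pow_sub_self hp heq
  rw [← map_pow, ← map_sub] at heq
  have hpoly := RatFunc.algebraMap_injective k heq
  have hcoeff (n : ℕ) : (if n = 0 then b else 0) + a n = (q ^ p - q).coeff n := by
    rw [← hpoly, Polynomial.coeff_add, Polynomial.coeff_C,
      Polynomial.coeff_finsuppSum_C_mul_X_pow]
  have ha' (n : ℕ) (hn : p ∣ n) : a n = 0 := by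
    by_contra hne
    exact (ha n (Finsupp.mem_support_iff.mpr hne)).2 hn
  have hq : q.natDegree = 0 := by
    by_contra hq
    have hdeg := Polynomial.natDegree_pow_sub_self hp q
    have hne : p * q.natDegree ≠ 0 := mul_ne_zero (by omega) hq
    have hlead := hcoeff (p * q.natDegree)
    rw [if_neg hne, ha' _ (dvd_mul_right ..), add_zero, ← hdeg, Polynomial.coeff_natDegree] at hlead
    rw [Polynomial.leadingCoeff_eq_zero.mp hlead.symm, Polynomial.natDegree_zero] at hdeg
    exact hne hdeg.symm
  obtain ⟨c, rfl⟩ := Polynomial.natDegree_eq_zero.mp hq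
  simp only [← Polynomial.C_pow, ← Polynomial.C_sub, Polynomial.coeff_C] at hcoeff
  constructor
  · ext n
    rcases eq_or_ne n 0 with rfl | hn
    · exact ha' 0 (dvd_zero p)
    · simpa [hn] using hcoeff n
  · exact ⟨c, by simpa [ha' 0 (dvd_zero p)] using (hcoeff 0).symm⟩
end

section
/- Let p be a prime, K a field of characteristic p, and let B ⊆ K be a subset whose image in K/℘K is an 𝔽_p-basis (where ℘t = t^p − t on K). Then for every n ≥ 1 and every x ∈ W(K) there exist a finitely supported function c : B → ℤ_p and elements y, z ∈ W(K) such that x = ∑_{b ∈ B} c(b)·[b] + ℘y + V^n z, where [b] is the Teichmüller lift of b, c(b) acts through the natural map ℤ_p = W(𝔽_p) → W(K), and V^n is the n-th iterate of the Verschiebung. -/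
section

variable {p : ℕ} [Fact p.Prime]

/-- The additive map `c ↦ ∑ b, c(b)·[b]` on finitely supported `W(𝔽_p)`-valued functions. -/
noncomputable def teichmullerSum {K : Type*} [Field K] [CharP K p] (B : Set K) :
    (B →₀ WittVector p (ZMod p)) →+ WittVector p K :=
  Finsupp.liftAddHom fun b : B =>
    (AddMonoidHom.mulRight (WittVector.teichmuller p (b : K))).comp
      (WittVector.map (ZMod.castHom (dvd_refl p) K)).toAddMonoidHom

theorem teichmullerSum_apply {K : Type*} [Field K] [CharP K p] (B : Set K)
    (c : B →₀ WittVector p (ZMod p)) :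
    teichmullerSum B c = c.sum fun b d =>
      WittVector.map (ZMod.castHom (dvd_refl p) K) d * WittVector.teichmuller p (b : K) :=
  rfl

theorem WittVector.exists_eq_verschiebung {R : Type*} [CommRing R] {x : WittVector p R}
    (h : x.coeff 0 = 0) : ∃ z : WittVector p R, x = WittVector.verschiebung z :=
  ⟨x.shift 1, WittVector.eq_iterate_verschiebung (n := 1) fun i hi => by
    rwa [Nat.lt_one_iff.mp hi]⟩

/-- In characteristic `p`, `V^n w` agrees with `p^n w` modulo the image of `F - 1`. -/
theorem WittVector.exists_iterate_verschiebung_eq {R : Type*} [CommRing R] [CharP R p]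
    (n : ℕ) (w : WittVector p R) :
    ∃ y : WittVector p R, (fun v : WittVector p R => WittVector.verschiebung v)^[n] w =
      p ^ n • w + (WittVector.frobenius y - y) := by
  induction n with
  | zero => exact ⟨0, by simp⟩
  | succ n ih =>
    obtain ⟨y, hy⟩ := ih
    refine ⟨WittVector.verschiebung y - p ^ n • WittVector.verschiebung w, ?_⟩
    rw [Function.iterate_succ_apply', hy]
    simp only [map_add, map_sub, map_nsmul, WittVector.verschiebung_frobenius_comm.eq,
      WittVector.frobenius_verschiebung]
    simp only [nsmul_eq_mul]
    push_cast
    ring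

/-- `V^n` preserves the image of `F - 1`. -/
theorem WittVector.iterate_verschiebung_frobenius_sub {R : Type*} [CommRing R] [CharP R p]
    (n : ℕ) (y : WittVector p R) :
    ∃ y' : WittVector p R, (fun v : WittVector p R => WittVector.verschiebung v)^[n]
      (WittVector.frobenius y - y) = WittVector.frobenius y' - y' := by
  induction n with
  | zero => exact ⟨y, rfl⟩
  | succ n ih =>
    obtain ⟨y', hy⟩ := ih
    refine ⟨WittVector.verschiebung y', ?_⟩
    rw [Function.iterate_succ_apply', hy, map_sub, WittVector.verschiebung_frobenius_comm.eq]

theorem exists_teichmullerSum_add_verschiebung {K : Type*} [Field K] [CharP K p] {B : Set K}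
    (hspan : ∀ t : K, ∃ (c : B →₀ ZMod p) (y : K),
      t = (c.sum fun b m => (m.val : K) * (b : K)) + (y ^ p - y)) (x : WittVector p K) :
    ∃ (c : B →₀ WittVector p (ZMod p)) (y z : WittVector p K),
      x = teichmullerSum B c + (WittVector.frobenius y - y) + WittVector.verschiebung z := by
  obtain ⟨c, t, h⟩ := hspan (x.coeff 0)
  let c' := c.mapRange (WittVector.teichmuller p) (WittVector.teichmuller_zero p)
  have hc : (teichmullerSum B c').coeff 0 = c.sum fun b m => (m.val : K) * (b : K) := by
    change WittVector.constantCoeff _ = _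
    rw [teichmullerSum_apply, map_finsuppSum, Finsupp.sum_mapRange_index (by simp)]
    refine Finsupp.sum_congr fun b _ => ?_
    change WittVector.constantCoeff (WittVector.map _ _ * _) = _
    rw [map_mul, WittVector.map_teichmuller]
    simp [WittVector.constantCoeff, WittVector.teichmuller_coeff_zero]
  let y := WittVector.teichmuller p t
  obtain ⟨z, hz⟩ := WittVector.exists_eq_verschiebung
    (x := x - (teichmullerSum B c' + (WittVector.frobenius y - y))) (by
      change WittVector.constantCoeff (x - (teichmullerSum B c' + (WittVector.frobenius y - y))) = 0
      simp only [map_sub, map_add]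
      change x.coeff 0 - ((teichmullerSum B c').coeff 0 +
        ((WittVector.frobenius y).coeff 0 - y.coeff 0)) = 0
      rw [hc, h, WittVector.coeff_frobenius_charP, WittVector.teichmuller_coeff_zero]
      ring)
  exact ⟨c', y, z, by rw [← hz]; ring⟩

end

/-- Let `p` be a prime, `K` a field of characteristic `p`, and `B ⊆ K` a subset
whose image in `K/℘K` is an `𝔽_p`-basis (`℘t = t^p - t`).  Then for every `n ≥ 1` and every
`x ∈ W(K)` there are a finitely supported function `c : B → ℤ_p = W(𝔽_p)` and `y, z ∈ W(K)` with
`x = ∑_{b ∈ B} c(b)·[b] + ℘y + Vⁿz`, where `[b]` is the Teichmüller lift, `c(b)` acts through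
`W(𝔽_p) → W(K)`, and `V` is the Verschiebung. -/
theorem wittVector_basis_representation (p : ℕ) [Fact p.Prime]
    (K : Type*) [Field K] [CharP K p] (B : Set K)
    (hspan : ∀ t : K, ∃ (c : B →₀ ZMod p) (y : K),
      t = (c.sum fun b m => (m.val : K) * (b : K)) + (y ^ p - y))
    (hindep : ∀ c : B →₀ ZMod p,
      (∃ y : K, (c.sum fun b m => (m.val : K) * (b : K)) = y ^ p - y) → c = 0)
    (n : ℕ) (hn : 1 ≤ n) (x : WittVector p K) :
    ∃ (c : B →₀ WittVector p (ZMod p)) (y z : WittVector p K),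
      x = (c.sum fun b d =>
            WittVector.map (ZMod.castHom (dvd_refl p) K) d
              * WittVector.teichmuller p (b : K))
        + (WittVector.frobenius y - y)
        + (fun v : WittVector p K => WittVector.verschiebung v)^[n] z := by
  clear hn
  simp only [← teichmullerSum_apply]
  induction n with
  | zero => exact ⟨0, 0, x, by simp⟩
  | succ n ih =>
    obtain ⟨c, y, z, hx⟩ := ih
    obtain ⟨c₁, y₁, z₁, hz⟩ := exists_teichmullerSum_add_verschiebung hspan z
    obtain ⟨y₂, hy₂⟩ := WittVector.exists_iterate_verschiebung_eq n (teichmullerSum B c₁)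
    obtain ⟨y₃, hy₃⟩ := WittVector.iterate_verschiebung_frobenius_sub n y₁
    refine ⟨c + p ^ n • c₁, y + y₂ + y₃, z₁, ?_⟩
    have key := congrArg (fun v : WittVector p K => WittVector.verschiebung v)^[n] hz
    rw [iterate_map_add (WittVector.verschiebung (p := p) (R := K)),
      iterate_map_add (WittVector.verschiebung (p := p) (R := K))] at key
    rw [hx, key, hy₂, hy₃, Function.iterate_succ_apply]
    simp only [map_add, map_nsmul]
    ring
end

section
/- Let p be a prime, K a field of characteristic p, and let B ⊆ K be a subset whose image in K/℘K is an 𝔽_p-basis (where ℘t = t^p − t on K). Let n ≥ 1 and let c : B → ℤ_p be a finitely supported function such that ∑_{b ∈ B} c(b)·[b] ∈ ℘W(K) + V^n W(K). Then p^n divides c(b) in ℤ_p for every b ∈ B. -/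
namespace WittVector

variable {p : ℕ} [Fact p.Prime]

theorem eq_verschiebung_shift_one {R : Type*} [CommRing R] {x : WittVector p R}
    (hx : x.coeff 0 = 0) : x = verschiebung (x.shift 1) := by
  rw [verschiebung_shift x 0 (by simpa using hx)]
  ext i
  simp [shift_coeff]

theorem frobenius_zmod (x : WittVector p (ZMod p)) : frobenius x = x := by
  ext i
  rw [coeff_frobenius_charP, ZMod.pow_card]

theorem natCast_mul_eq_verschiebung_frobenius {R : Type*} [CommRing R] [CharP R p]
    (x : WittVector p R) : (p : WittVector p R) * x = verschiebung (frobenius x) := by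
  rw [verschiebung_frobenius, mul_comm]

theorem frobenius_teichmuller {R : Type*} [CommRing R] [CharP R p] (r : R) :
    frobenius (teichmuller p r) = teichmuller p (r ^ p) := by
  rw [frobenius_eq_map_frobenius, map_teichmuller, frobenius_def]

/-- If `℘y` vanishes in degree zero, then `℘y = ℘(V y')` for some `y'`. -/
theorem exists_frobenius_sub_self_eq_of_coeff_zero {R : Type*} [CommRing R] [CharP R p]
    {y : WittVector p R} (hy : y.coeff 0 ^ p = y.coeff 0) :
    ∃ y' : WittVector p R, frobenius y - y = verschiebung (frobenius y' - y') := by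
  set t := teichmuller p (y.coeff 0) with ht
  have h0 : (y - t).coeff 0 = 0 := by
    have := map_sub (constantCoeff (p := p) (R := R)) y t
    simpa [ht, teichmuller_coeff_zero] using this
  have hy' := eq_verschiebung_shift_one h0
  refine ⟨(y - t).shift 1, ?_⟩
  have hF : frobenius (y - t) = verschiebung (frobenius ((y - t).shift 1)) := by
    rw [verschiebung_frobenius, ← frobenius_verschiebung, ← hy']
  rw [map_sub, ← hF, ← hy', map_sub, frobenius_teichmuller, hy]
  ring

end WittVector

open WittVector in

/-- Let `p` be a prime, `K` a field of characteristic `p`, and `B ⊆ K` a subset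
whose image in `K/℘K` is an `𝔽_p`-basis (`℘t = t^p - t`).  Let `n ≥ 1` and let
`c : B → ℤ_p = W(𝔽_p)` be finitely supported with `∑_{b ∈ B} c(b)·[b] ∈ ℘W(K) + Vⁿ W(K)`.
Then `pⁿ` divides `c(b)` for every `b ∈ B`. -/
theorem wittVector_basis_independence (p : ℕ) [Fact p.Prime]
    (K : Type*) [Field K] [CharP K p] (B : Set K)
    (hspan : ∀ t : K, ∃ (c : B →₀ ZMod p) (y : K),
      t = (c.sum fun b m => (m.val : K) * (b : K)) + (y ^ p - y))
    (hindep : ∀ c : B →₀ ZMod p,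
      (∃ y : K, (c.sum fun b m => (m.val : K) * (b : K)) = y ^ p - y) → c = 0)
    (n : ℕ) (hn : 1 ≤ n) (c : B →₀ WittVector p (ZMod p))
    (hc : ∃ y z : WittVector p K,
      (c.sum fun b d =>
          WittVector.map (ZMod.castHom (dvd_refl p) K) d
            * WittVector.teichmuller p (b : K))
        = (WittVector.frobenius y - y)
          + (fun v : WittVector p K => WittVector.verschiebung v)^[n] z) :
    ∀ b : B, (p : WittVector p (ZMod p)) ^ n ∣ c b := by
  clear hn
  obtain ⟨y, z, hc⟩ := hc
  induction n generalizing c y with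
  | zero => simp
  | succ n ih =>
    rw [Function.iterate_succ_apply'] at hc
    have hc0 : c.mapRange (constantCoeff (p := p) (R := ZMod p)) (map_zero _) = 0 := by
      refine hindep _ ⟨y.coeff 0, ?_⟩
      have h := congrArg (constantCoeff (p := p) (R := K)) hc
      rw [map_finsuppSum, map_add, map_sub] at h
      rw [Finsupp.sum_mapRange_index (by simp)]
      simpa [coeff_frobenius_charP, verschiebung_coeff_zero, map_coeff, mul_coeff_zero,
        teichmuller_coeff_zero] using h
    have hcoeff : ∀ b, (c b).coeff 0 = 0 := fun b ↦ by simpa using DFunLike.congr_fun hc0 b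
    set d := c.mapRange (fun w ↦ w.shift 1) (by ext; simp [shift_coeff]) with hd
    have hcd : ∀ b, c b = p * d b := fun b ↦ by
      rw [natCast_mul_eq_verschiebung_frobenius, frobenius_zmod, hd, Finsupp.mapRange_apply]
      exact eq_verschiebung_shift_one (hcoeff b)
    set S := d.sum fun b w ↦ WittVector.map (ZMod.castHom (dvd_refl p) K) w *
      teichmuller p (b : K) with hS
    have hsum : (c.sum fun b w ↦ WittVector.map (ZMod.castHom (dvd_refl p) K) w *
        teichmuller p (b : K)) = verschiebung (frobenius S) := by
      have : c = d.mapRange (fun w ↦ (p : WittVector p (ZMod p)) * w) (mul_zero _) := by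
        ext1 b
        simp [hcd]
      rw [this, Finsupp.sum_mapRange_index (by simp), ← natCast_mul_eq_verschiebung_frobenius,
        hS, Finsupp.mul_sum]
      simp only [map_mul, map_natCast, mul_assoc]
    rw [hsum] at hc
    have hy : y.coeff 0 ^ p = y.coeff 0 := by
      have h := congrArg (constantCoeff (p := p) (R := K)) hc
      rw [map_add, map_sub] at h
      refine sub_eq_zero.mp (Eq.symm ?_)
      simpa [coeff_frobenius_charP, verschiebung_coeff_zero] using h
    obtain ⟨y', hy'⟩ := exists_frobenius_sub_self_eq_of_coeff_zero hy
    rw [hy', ← map_add] at hc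
    have hFS := verschiebung_injective p K hc
    have := ih d (y' - S) (by rw [map_sub, ← hS]; linear_combination hFS)
    intro b
    rw [hcd, pow_succ']
    exact mul_dvd_mul_left _ (this b)
end

section
/- Let p be a prime, k a finite field of characteristic p, K = k((T)), and fix α ∈ k with Tr_{k/𝔽_p}(α) ≠ 0. Let n ≥ 1, c ∈ ℤ_p, and let (c_i) be a finitely supported family of elements of W(k) indexed by positive integers i coprime to p. If c·[α] + ∑_i ι(c_i)·[T^{−i}] ∈ ℘W(K) + V^n W(K), then p^n divides c in ℤ_p and p^n divides c_i in W(k) for every i. -/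
theorem WittVector.exists_eq_verschiebung_of_coeff_zero {p : ℕ} [Fact p.Prime] {R : Type*}
    [CommRing R] {x : WittVector p R} (hx : x.coeff 0 = 0) :
    ∃ w, x = WittVector.verschiebung w :=
  ⟨x.shift 1, by simpa using WittVector.eq_iterate_verschiebung (n := 1) (by simp [hx])⟩

/-- Over a ring of characteristic `p`, if `p * x` lies in `℘ W(R) + V^(n+1) W(R)`, then
`x` lies in `℘ W(R) + V^n W(R)`. -/
theorem WittVector.exists_eq_frobenius_sub_add_of_mul_p {p : ℕ} [Fact p.Prime] {R : Type*}
    [CommRing R] [CharP R p] {n : ℕ} {x y z : WittVector p R}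
    (h : x * p = (WittVector.frobenius y - y)
      + (fun v : WittVector p R => WittVector.verschiebung v)^[n + 1] z) :
    ∃ w, x = (WittVector.frobenius w - w)
      + (fun v : WittVector p R => WittVector.verschiebung v)^[n] z := by
  rw [Function.iterate_succ_apply'] at h
  set t := (fun v : WittVector p R => WittVector.verschiebung v)^[n] z
  have hy : y.coeff 0 ^ p = y.coeff 0 := by
    have := congrArg WittVector.constantCoeff h
    simp only [map_add, map_sub, WittVector.constantCoeff_apply,
      WittVector.mul_charP_coeff_zero, WittVector.coeff_frobenius_charP,
      WittVector.verschiebung_coeff_zero, add_zero] at this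
    exact (sub_eq_zero.mp this.symm)
  have hF : WittVector.frobenius (WittVector.teichmuller p (y.coeff 0)) =
      WittVector.teichmuller p (y.coeff 0) := by
    rw [WittVector.frobenius_eq_map_frobenius, WittVector.map_teichmuller, frobenius_def, hy]
  obtain ⟨w, hw⟩ := WittVector.exists_eq_verschiebung_of_coeff_zero
    (x := y - WittVector.teichmuller p (y.coeff 0)) (by
      have := (WittVector.constantCoeff (p := p) (R := R)).map_sub y
        (WittVector.teichmuller p (y.coeff 0))
      simpa only [WittVector.constantCoeff_apply, WittVector.teichmuller_coeff_zero,
        sub_self] using this)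
  have hw' : WittVector.frobenius y - WittVector.teichmuller p (y.coeff 0) =
      WittVector.verschiebung (WittVector.frobenius w) := by
    rw [WittVector.verschiebung_frobenius_comm w, ← hw, map_sub, hF]
  have key : WittVector.frobenius x = WittVector.frobenius w - w + t := by
    apply WittVector.verschiebung_injective p R
    rw [WittVector.verschiebung_frobenius, h, map_add, map_sub, ← hw', ← hw]
    ring
  refine ⟨w - x, ?_⟩
  rw [map_sub, key]
  ring

theorem PowerSeries.map_frobenius_expand {R : Type*} [CommRing R] (p : ℕ) (hp : p ≠ 0)
    [ExpChar R p] (f : PowerSeries R) :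
    (PowerSeries.expand p hp f).map (frobenius R p) = f ^ p :=
  MvPowerSeries.map_frobenius_expand p hp

theorem LaurentSeries.pow_eq_single_mul {R : Type*} [CommRing R] (f : LaurentSeries R) (n : ℕ) :
    f ^ n = HahnSeries.single (n * f.order) 1 *
      ((f.powerSeriesPart ^ n : PowerSeries R) : LaurentSeries R) := by
  conv_lhs => rw [← f.single_order_mul_powerSeriesPart]
  rw [mul_pow, HahnSeries.single_pow, one_pow, nsmul_eq_mul, map_pow]

theorem LaurentSeries.coeff_pow_char {R : Type*} [CommRing R] (p : ℕ) [Fact p.Prime] [CharP R p]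
    (f : LaurentSeries R) (j : ℤ) :
    (f ^ p).coeff (p * j) = f.coeff j ^ p := by
  have hp : p ≠ 0 := (Fact.out : p.Prime).ne_zero
  have hp' : (0 : ℤ) < p := by exact_mod_cast Nat.pos_of_ne_zero hp
  obtain ⟨m, rfl⟩ : ∃ m, j = m + f.order := ⟨j - f.order, by ring⟩
  have hf : f.coeff (m + f.order) = (f.powerSeriesPart : LaurentSeries R).coeff m := by
    conv_lhs => enter [1]; rw [← f.single_order_mul_powerSeriesPart]
    rw [HahnSeries.coeff_single_mul_add, one_mul]
  rw [LaurentSeries.pow_eq_single_mul, hf, mul_add, HahnSeries.coeff_single_mul_add, one_mul,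
    PowerSeries.coeff_coe, PowerSeries.coeff_coe]
  by_cases hm : m < 0
  · rw [if_pos hm, if_pos (mul_neg_of_pos_of_neg hp' hm), zero_pow hp]
  · rw [if_neg hm, if_neg (by nlinarith), ← PowerSeries.map_frobenius_expand p hp, Int.natAbs_mul,
      Int.natAbs_natCast, PowerSeries.coeff_map, PowerSeries.coeff_expand_mul, frobenius_def]

theorem LaurentSeries.coeff_pow_char_of_not_dvd {R : Type*} [CommRing R] (p : ℕ) [Fact p.Prime]
    [CharP R p] (f : LaurentSeries R) {j : ℤ} (hj : ¬ (p : ℤ) ∣ j) :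
    (f ^ p).coeff j = 0 := by
  have hp : p ≠ 0 := (Fact.out : p.Prime).ne_zero
  obtain ⟨m, rfl⟩ : ∃ m, j = m + p * f.order := ⟨j - p * f.order, by ring⟩
  rw [LaurentSeries.pow_eq_single_mul, HahnSeries.coeff_single_mul_add, one_mul, PowerSeries.coeff_coe]
  split_ifs with hm
  · rfl
  · rw [← PowerSeries.map_frobenius_expand p hp, PowerSeries.coeff_map,
      PowerSeries.coeff_expand_of_not_dvd, map_zero]
    rw [← Int.natCast_dvd]
    exact fun h => hj (h.add (dvd_mul_right _ _))

/-- A Laurent series `f` such that the coefficients of `f ^ p - f` in the degrees `j p ^ m`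
with `m ≥ 1` vanish has no term in the negative degree `j`. -/
theorem LaurentSeries.coeff_eq_zero_of_pow_char {R : Type*} [CommRing R] [IsReduced R] (p : ℕ)
    [Fact p.Prime] [CharP R p] (f : LaurentSeries R) {j : ℤ} (hj : j < 0)
    (h : ∀ m : ℕ, (f ^ p - f).coeff (p * (p ^ m * j)) = 0) : f.coeff j = 0 := by
  have hpow : ∀ m : ℕ, f.coeff (p ^ m * j) = f.coeff j ^ p ^ m := by
    intro m
    induction m with
    | zero => simp
    | succ m ih =>
      have := h m
      rw [HahnSeries.coeff_sub, sub_eq_zero, LaurentSeries.coeff_pow_char, ih, ← pow_mul,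
        ← pow_succ, ← mul_assoc, ← pow_succ'] at this
      exact this.symm
  by_contra hne
  obtain ⟨m, hm⟩ := pow_unbounded_of_one_lt (-f.order) (y := (p : ℤ))
    (by exact_mod_cast (Fact.out : p.Prime).one_lt)
  have h0 : f.coeff (p ^ m * j) = 0 := by
    apply HahnSeries.coeff_eq_zero_of_lt_order
    have hpm : (0 : ℤ) ≤ (p : ℤ) ^ m := by positivity
    nlinarith
  rw [hpow] at h0
  exact hne (eq_zero_of_pow_eq_zero h0)

/-- Additive independence modulo `x ↦ x ^ p - x` in `k((T))`, for `k` a finite field. -/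
theorem LaurentSeries.artinSchreier_independence (p : ℕ) [Fact p.Prime]
    (k : Type*) [Field k] [Finite k] [CharP k p] [Algebra (ZMod p) k]
    (α : k) (hα : Algebra.trace (ZMod p) k α ≠ 0) (c : ZMod p) (s : Finset ℕ) (a : ℕ → k)
    (hs : ∀ i ∈ s, 0 < i ∧ ¬ p ∣ i) (f : LaurentSeries k)
    (h : HahnSeries.C (algebraMap (ZMod p) k c * α)
      + ∑ i ∈ s, HahnSeries.single (-(i : ℤ)) (a i) = f ^ p - f) :
    c = 0 ∧ ∀ i ∈ s, a i = 0 := by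
  have hp : p ≠ 0 := (Fact.out : p.Prime).ne_zero
  have hcoeff : ∀ j : ℤ, (f ^ p - f).coeff j = (if j = 0 then algebraMap (ZMod p) k c * α else 0)
      + ∑ i ∈ s, if j = -(i : ℤ) then a i else 0 := by
    intro j
    rw [← h, HahnSeries.coeff_add, HahnSeries.coeff_sum, HahnSeries.C_apply,
      HahnSeries.coeff_single]
    simp only [HahnSeries.coeff_single]
    exact congrArg₂ _ (by congr) (Finset.sum_congr rfl fun i _ => by congr)
  constructor
  · have h0 := hcoeff 0
    rw [if_pos rfl, Finset.sum_eq_zero, add_zero, HahnSeries.coeff_sub] at h0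
    · have h1 := LaurentSeries.coeff_pow_char p f 0
      rw [mul_zero] at h1
      rw [h1, ← Algebra.smul_def] at h0
      have h2 := congrArg (Algebra.trace (ZMod p) k) h0
      have h3 : Algebra.trace (ZMod p) k (f.coeff 0 ^ p) =
          Algebra.trace (ZMod p) k (f.coeff 0) := by
        have := Algebra.trace_eq_of_algEquiv
          (FiniteField.frobeniusAlgEquivOfAlgebraic (ZMod p) k) (f.coeff 0)
        simpa [ZMod.card] using this
      rw [map_sub, h3, sub_self, map_smul, smul_eq_mul] at h2
      exact (mul_eq_zero.mp h2.symm).resolve_right hα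
    · intro i hi
      have := (hs i hi).1
      exact if_neg (by omega)
  · intro i hi
    obtain ⟨hi0, hip⟩ := hs i hi
    have hdvd : ¬ (p : ℤ) ∣ -(i : ℤ) := by
      rwa [dvd_neg, Int.natCast_dvd_natCast]
    have hfi : f.coeff (-(i : ℤ)) = 0 := by
      apply LaurentSeries.coeff_eq_zero_of_pow_char p f (by omega)
      intro m
      rw [hcoeff, if_neg, zero_add]
      · apply Finset.sum_eq_zero
        intro l hl
        refine if_neg fun he => (hs l hl).2 ?_
        rw [← Int.natCast_dvd_natCast, ← dvd_neg, ← he]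
        exact dvd_mul_right _ _
      · simp [hp]
        omega
    have h1 := hcoeff (-(i : ℤ))
    rw [HahnSeries.coeff_sub, LaurentSeries.coeff_pow_char_of_not_dvd p f hdvd, hfi, sub_zero,
      if_neg (by omega), zero_add, Finset.sum_eq_single i] at h1
    · simpa using h1.symm
    · intro l _ hl
      exact if_neg (by omega)
    · exact fun hn => absurd hi hn

theorem LaurentSeries.wittVector_independence (p : ℕ) [Fact p.Prime]
    (k : Type*) [Field k] [Finite k] [CharP k p] [Algebra (ZMod p) k]
    (α : k) (hα : Algebra.trace (ZMod p) k α ≠ 0) (s : Finset ℕ)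
    (hs : ∀ i ∈ s, 0 < i ∧ ¬ p ∣ i) (n : ℕ) (c : WittVector p (ZMod p)) (a : ℕ → WittVector p k)
    (y z : WittVector p (LaurentSeries k))
    (h : WittVector.map ((HahnSeries.C : k →+* LaurentSeries k).comp
            (ZMod.castHom (dvd_refl p) k)) c
          * WittVector.teichmuller p (HahnSeries.C α)
        + (∑ i ∈ s,
            WittVector.map (HahnSeries.C : k →+* LaurentSeries k) (a i)
              * WittVector.teichmuller p (HahnSeries.single (-(i : ℤ)) 1))
      = (WittVector.frobenius y - y)
        + (fun v : WittVector p (LaurentSeries k) => WittVector.verschiebung v)^[n] z) :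
    (p : WittVector p (ZMod p)) ^ n ∣ c ∧
    ∀ i ∈ s, (p : WittVector p k) ^ n ∣ a i := by
  have : CharP (LaurentSeries k) p :=
    charP_of_injective_ringHom (HahnSeries.C_injective (Γ := ℤ) (R := k)) p
  induction n generalizing c a y z with
  | zero => simp
  | succ n ih =>
    have h0 : c.coeff 0 = 0 ∧ ∀ i ∈ s, (a i).coeff 0 = 0 := by
      apply LaurentSeries.artinSchreier_independence p k α hα (c.coeff 0) s
        (fun i => (a i).coeff 0) hs (y.coeff 0)
      have := congrArg WittVector.constantCoeff h
      rw [Function.iterate_succ_apply'] at this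
      simp only [map_add, map_sub, map_sum, map_mul, WittVector.constantCoeff_apply,
        WittVector.coeff_frobenius_charP, WittVector.map_coeff, WittVector.teichmuller_coeff_zero,
        WittVector.verschiebung_coeff_zero, add_zero] at this
      rw [← this, map_mul]
      congr 1
      · rw [Subsingleton.elim (algebraMap (ZMod p) k) (ZMod.castHom (dvd_refl p) k)]
        rfl
      · refine Finset.sum_congr rfl fun i _ => ?_
        rw [HahnSeries.C_apply, HahnSeries.single_mul_single, zero_add, mul_one]
    obtain ⟨c', rfl⟩ : (p : WittVector p (ZMod p)) ∣ c := by
      rw [← Ideal.mem_span_singleton, WittVector.mem_span_p_iff_coeff_zero_eq_zero]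
      exact h0.1
    have hdvd : ∀ i, ∃ b, i ∈ s → a i = p * b := by
      intro i
      by_cases hi : i ∈ s
      · obtain ⟨b, hb⟩ : (p : WittVector p k) ∣ a i := by
          rw [← Ideal.mem_span_singleton, WittVector.mem_span_p_iff_coeff_zero_eq_zero]
          exact h0.2 i hi
        exact ⟨b, fun _ => hb⟩
      · exact ⟨0, fun hi' => absurd hi' hi⟩
    choose b hb using hdvd
    have hfactor : (WittVector.map ((HahnSeries.C : k →+* LaurentSeries k).comp
            (ZMod.castHom (dvd_refl p) k)) c'
          * WittVector.teichmuller p (HahnSeries.C α)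
        + (∑ i ∈ s,
            WittVector.map (HahnSeries.C : k →+* LaurentSeries k) (b i)
              * WittVector.teichmuller p (HahnSeries.single (-(i : ℤ)) 1))) *
          (p : WittVector p (LaurentSeries k)) =
        (WittVector.frobenius y - y)
        + (fun v : WittVector p (LaurentSeries k) => WittVector.verschiebung v)^[n + 1] z := by
      refine Eq.trans ?_ h
      rw [add_mul, Finset.sum_mul]
      refine congrArg₂ _ ?_ (Finset.sum_congr rfl fun i hi => ?_)
      · rw [map_mul, map_natCast, mul_right_comm, mul_comm (p : WittVector p (LaurentSeries k))]
      · rw [hb i hi, map_mul, map_natCast, mul_right_comm,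
          mul_comm (p : WittVector p (LaurentSeries k))]
    obtain ⟨w, hw⟩ := WittVector.exists_eq_frobenius_sub_add_of_mul_p hfactor
    obtain ⟨h1, h2⟩ := ih c' b w z hw
    refine ⟨?_, fun i hi => ?_⟩
    · rw [pow_succ']
      exact mul_dvd_mul_left _ h1
    · rw [hb i hi, pow_succ']
      exact mul_dvd_mul_left _ (h2 i hi)


/-- Let `p` be a prime, `k` a finite field of characteristic `p`,
`K = k((T))`, and `α ∈ k` with `Tr_{k/𝔽_p}(α) ≠ 0`.  Let `n ≥ 1`, `c ∈ ℤ_p = W(𝔽_p)`, and let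
`(c_i)` be a finitely supported family of elements of `W(k)` indexed by positive integers `i`
coprime to `p`.  If `c·[α] + ∑_i ι(c_i)·[T^{-i}] ∈ ℘W(K) + Vⁿ W(K)`, then `pⁿ ∣ c` in
`ℤ_p = W(𝔽_p)` and `pⁿ ∣ c_i` in `W(k)` for every `i`. -/
theorem localField_wittVector_independence (p : ℕ) [Fact p.Prime]
    (k : Type*) [Field k] [Fintype k] [CharP k p] [Algebra (ZMod p) k]
    (α : k) (hα : Algebra.trace (ZMod p) k α ≠ 0)
    (n : ℕ) (hn : 1 ≤ n) (c : WittVector p (ZMod p)) (a : ℕ →₀ WittVector p k)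
    (ha : ∀ i ∈ a.support, 0 < i ∧ ¬ p ∣ i)
    (h : ∃ y z : WittVector p (LaurentSeries k),
      WittVector.map ((HahnSeries.C : k →+* LaurentSeries k).comp
            (ZMod.castHom (dvd_refl p) k)) c
          * WittVector.teichmuller p (HahnSeries.C α)
        + (a.sum fun i d =>
            WittVector.map (HahnSeries.C : k →+* LaurentSeries k) d
              * WittVector.teichmuller p (HahnSeries.single (-(i : ℤ)) 1))
      = (WittVector.frobenius y - y)
        + (fun v : WittVector p (LaurentSeries k) => WittVector.verschiebung v)^[n] z) :
    (p : WittVector p (ZMod p)) ^ n ∣ c ∧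
    ∀ i, (p : WittVector p k) ^ n ∣ a i := by
  obtain ⟨y, z, h⟩ := h
  obtain ⟨h1, h2⟩ :=
    LaurentSeries.wittVector_independence p k α hα a.support ha n c a y z h
  refine ⟨h1, fun i => ?_⟩
  by_cases hi : i ∈ a.support
  · exact h2 i hi
  · rw [Finsupp.notMem_support_iff.mp hi]
    exact dvd_zero _
end
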